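/- (Classical Abhyankar–Moh theorem on degrees.) Let p, q ∈ ℂ[t] be nonconstant polynomials in one variable such that the ℂ-subalgebra of ℂ[t] generated by p and q is all of ℂ[t] (i.e., ℂ[p,q] = ℂ[t]). Then deg p divides deg q or deg q divides deg p. -/

import Mathlib

open Polynomial WithZero

namespace AbhyankarMoh

lemma degree_C_mul_le {R : Type*} [CommRing R] (a : R) (f : R[X]) :
    (C a * f).degree ≤ f.degree := by
  rw [← smul_eq_C_mul]
  exact degree_smul_le a f

lemma degree_divByMonic_lt_of_lt {R : Type*} [CommRing R] [Nontrivial R] {G h : R[X]}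
    (hG : G.Monic) {b : ℕ} (hh : h.degree < ((G.natDegree + b : ℕ) : WithBot ℕ)) :
    (h /ₘ G).degree < b := by
  by_cases hlt : h.degree < G.degree
  · rw [(divByMonic_eq_zero_iff hG).2 hlt, degree_zero]
    exact WithBot.bot_lt_coe b
  · have h1 := degree_add_divByMonic hG (not_lt.1 hlt)
    by_cases hq : h /ₘ G = 0
    · rw [hq, degree_zero]
      exact WithBot.bot_lt_coe b
    · rw [← h1, degree_eq_natDegree hG.ne_zero, degree_eq_natDegree hq] at hh
      rw [degree_eq_natDegree hq]
      norm_cast at hh ⊢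
      omega

/-- Values of a polynomial of degree `< k * deg G`, read off from its `G`-adic expansion. -/
lemma exists_val_eq {R : Type*} [CommRing R] [Nontrivial R] (v : Valuation R[X] ℤᵐ⁰)
    {A : ℤ → Prop} {d γ : ℤ} {G : R[X]} (hG : G.Monic) (hγ : v G = exp γ)
    (hA : ∀ a, A a → d ∣ a)
    (hlow : ∀ h : R[X], h ≠ 0 → h.degree < G.natDegree → ∃ a, A a ∧ v h = exp a)
    {e : ℕ} (he : ∀ j : ℤ, d ∣ j * γ → (e : ℤ) ∣ j) :
    ∀ k ≤ e, ∀ h : R[X], h ≠ 0 → h.degree < ((k * G.natDegree : ℕ) : WithBot ℕ) →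
      ∃ j < k, ∃ a, A a ∧ v h = exp (a + j * γ) := by
  intro k
  induction k with
  | zero =>
    intro _ h h0 hdeg
    simp [Nat.WithBot.lt_zero_iff, h0] at hdeg
  | succ k ih =>
    intro hk h h0 hdeg
    have hGk : (G ^ k).Monic := hG.pow k
    have hq : (h /ₘ G ^ k).degree < G.natDegree := by
      apply degree_divByMonic_lt_of_lt hGk
      rw [hG.natDegree_pow]
      convert hdeg using 2
      ring
    have hr : (h %ₘ G ^ k).degree < ((k * G.natDegree : ℕ) : WithBot ℕ) := by
      rw [← hG.natDegree_pow, ← degree_eq_natDegree hGk.ne_zero]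
      exact degree_modByMonic_lt h hGk
    have hsum := modByMonic_add_div h (G ^ k)
    by_cases hq0 : h /ₘ G ^ k = 0
    · rw [hq0, mul_zero, add_zero] at hsum
      obtain ⟨j, hj, a, ha, hv⟩ := ih (by omega) h h0 (hsum ▸ hr)
      exact ⟨j, by omega, a, ha, hv⟩
    obtain ⟨a, ha, hv⟩ := hlow _ hq0 hq
    have hvq : v (G ^ k * (h /ₘ G ^ k)) = exp (a + k * γ) := by
      rw [map_mul, map_pow, hγ, hv, ← exp_nsmul, ← exp_add, nsmul_eq_mul, add_comm]
    by_cases hr0 : h %ₘ G ^ k = 0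
    · rw [hr0, zero_add] at hsum
      exact ⟨k, by omega, a, ha, hsum ▸ hvq⟩
    obtain ⟨j, hj, b, hb, hvr⟩ := ih (by omega) _ hr0 hr
    have hne : v (h %ₘ G ^ k) ≠ v (G ^ k * (h /ₘ G ^ k)) := by
      rw [hvr, hvq, Ne, exp_inj]
      intro heq
      have hd : d ∣ ((k : ℤ) - j) * γ := by
        have : ((k : ℤ) - j) * γ = b - a := by linear_combination -heq
        rw [this]
        exact dvd_sub (hA b hb) (hA a ha)
      have := Int.le_of_dvd (by omega) (he _ hd)
      omega
    have hmax := v.map_add_of_distinct_val hne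
    rw [hsum] at hmax
    rcases max_choice (v (h %ₘ G ^ k)) (v (G ^ k * (h /ₘ G ^ k))) with hc | hc
    · exact ⟨j, by omega, b, hb, by rw [hmax, hc, hvr]⟩
    · exact ⟨k, by omega, a, ha, by rw [hmax, hc, hvq]⟩

lemma degree_add_pow_sub_lt {R : Type*} [CommRing R] [IsDomain R] {G r : R[X]} (hG : G.Monic)
    {k : ℕ} (hk : k < G.natDegree) (hr : r.degree ≤ k) (e : ℕ) :
    ((G + r) ^ (e + 1) - G ^ (e + 1) - (e + 1 : ℕ) * r * G ^ e).degree <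
      ((e * G.natDegree + k : ℕ) : WithBot ℕ) := by
  have hGr : (G + r).degree ≤ G.natDegree := by
    refine (degree_add_le _ _).trans (max_le degree_le_natDegree (hr.trans ?_))
    exact_mod_cast hk.le
  induction e with
  | zero =>
    have : (G + r) ^ (0 + 1) - G ^ (0 + 1) - ((0 + 1 : ℕ) : R[X]) * r * G ^ 0 = 0 := by
      push_cast
      ring
    rw [this, degree_zero]
    exact WithBot.bot_lt_coe _
  | succ e ih =>
    have hid : (G + r) ^ (e + 1 + 1) - G ^ (e + 1 + 1) - (e + 1 + 1 : ℕ) * r * G ^ (e + 1) =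
        ((G + r) ^ (e + 1) - G ^ (e + 1) - (e + 1 : ℕ) * r * G ^ e) * (G + r) +
          C ((e + 1 : ℕ) : R) * (r * r * G ^ e) := by
      rw [C_eq_natCast]
      push_cast
      ring
    rw [hid]
    refine (degree_add_le _ _).trans_lt (max_lt ?_ ?_)
    · rw [degree_mul]
      by_cases hz : G + r = 0
      · rw [hz, degree_zero, WithBot.add_bot]
        exact WithBot.bot_lt_coe _
      · rw [degree_eq_natDegree hz] at hGr ⊢
        calc _ < ((e * G.natDegree + k : ℕ) : WithBot ℕ) + (G + r).natDegree := by
              exact WithBot.add_lt_add_right (WithBot.coe_ne_bot) ih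
          _ ≤ _ := by
              norm_cast at hGr ⊢
              nlinarith
    · refine (degree_C_mul_le _ _).trans_lt ?_
      by_cases hz : r = 0
      · rw [hz]
        simp only [zero_mul, degree_zero]
        exact WithBot.bot_lt_coe _
      · rw [degree_mul, degree_mul, degree_pow, degree_eq_natDegree hG.ne_zero]
        rw [degree_eq_natDegree hz] at hr ⊢
        rw [nsmul_eq_mul]
        norm_cast at hr ⊢
        nlinarith

/-- Repeated Tschirnhausen transformation produces an approximate root. -/
lemma exists_approximate_root {R : Type*} [CommRing R] [IsDomain R] {u : R} {e N : ℕ}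
    (hu : ((e + 1 : ℕ) : R) * u = 1) {F : R[X]} (hF : F.Monic)
    (hFdeg : F.natDegree = (e + 1) * N) (P : R[X] → Prop)
    (hP : ∀ G : R[X], G.Monic → G.natDegree = N → P G →
      P (G + C u * ((F - G ^ (e + 1)) /ₘ G ^ e)))
    (hex : ∃ G : R[X], G.Monic ∧ G.natDegree = N ∧ P G) :
    ∃ G : R[X], G.Monic ∧ G.natDegree = N ∧ P G ∧
      (F - G ^ (e + 1)).degree < ((e * N : ℕ) : WithBot ℕ) := by
  have key : ∀ k ≤ N, ∀ G : R[X], G.Monic → G.natDegree = N → P G →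
      (F - G ^ (e + 1)).degree < ((e * N + k : ℕ) : WithBot ℕ) →
      ∃ G : R[X], G.Monic ∧ G.natDegree = N ∧ P G ∧
      (F - G ^ (e + 1)).degree < ((e * N : ℕ) : WithBot ℕ) := by
    intro k
    induction k with
    | zero => exact fun _ G h1 h2 h3 h4 => ⟨G, h1, h2, h3, h4⟩
    | succ k ih =>
      intro hk G hG hN hPG hdeg
      set c := (F - G ^ (e + 1)) /ₘ G ^ e with hc
      have hGe : (G ^ e).Monic := hG.pow e
      have hcdeg : c.degree < ((k + 1 : ℕ) : WithBot ℕ) := by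
        apply degree_divByMonic_lt_of_lt hGe
        rwa [hG.natDegree_pow, hN]
      have hrdeg : (C u * c).degree ≤ k :=
        (degree_C_mul_le _ _).trans <|
          (degree_le_iff_coeff_zero _ _).2 fun m hm =>
            (degree_lt_iff_coeff_zero _ _).1 hcdeg m (by exact_mod_cast hm)
      have hlt : (C u * c).degree < G.degree := by
        rw [degree_eq_natDegree hG.ne_zero, hN]
        exact hrdeg.trans_lt (by exact_mod_cast hk)
      have hE := degree_add_pow_sub_lt hG (k := k) (by omega) hrdeg e
      refine ih (by omega) (G + C u * c) (hG.add_of_left hlt)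
        (by rw [natDegree_add_eq_left_of_degree_lt hlt, hN]) (hP G hG hN hPG) ?_
      have hcr : ((e + 1 : ℕ) : R[X]) * (C u * c) = c := by
        rw [← mul_assoc, ← C_eq_natCast, ← C_mul, hu, C_1, one_mul]
      have hid : F - (G + C u * c) ^ (e + 1) = (F - G ^ (e + 1)) %ₘ G ^ e -
          ((G + C u * c) ^ (e + 1) - G ^ (e + 1) - (e + 1 : ℕ) * (C u * c) * G ^ e) := by
        rw [hcr]
        have := modByMonic_add_div (F - G ^ (e + 1)) (G ^ e)
        rw [← hc] at this
        linear_combination -this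
      rw [hid]
      refine (degree_sub_le _ _).trans_lt (max_lt ?_ (hN ▸ hE))
      refine (degree_modByMonic_lt _ hGe).trans_le ?_
      rw [degree_eq_natDegree hGe.ne_zero, hG.natDegree_pow, hN]
      exact_mod_cast Nat.le_add_right _ _
  obtain ⟨G, hG, hN, hPG⟩ := hex
  refine key N le_rfl G hG hN hPG ?_
  have hGe := hG.pow (e + 1)
  have hd : F.degree = (G ^ (e + 1)).degree := by
    rw [degree_eq_natDegree hF.ne_zero, degree_eq_natDegree hGe.ne_zero, hG.natDegree_pow, hN,
      hFdeg]
  have := degree_sub_lt_left hd hF.ne_zero (by rw [hF.leadingCoeff, hGe.leadingCoeff])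
  refine this.trans_eq ?_
  rw [degree_eq_natDegree hF.ne_zero, hFdeg]
  push_cast
  ring

lemma approximate_root_unique {R : Type*} [CommRing R] [IsDomain R] [CharZero R] {e N : ℕ}
    {F G H : R[X]} (hG : G.Monic) (hH : H.Monic) (hGN : G.natDegree = N) (hHN : H.natDegree = N)
    (hFG : (F - G ^ (e + 1)).degree < ((e * N : ℕ) : WithBot ℕ))
    (hFH : (F - H ^ (e + 1)).degree < ((e * N : ℕ) : WithBot ℕ)) : G = H := by
  by_contra hne
  have hlt : (G ^ (e + 1) - H ^ (e + 1)).degree < ((e * N : ℕ) : WithBot ℕ) := by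
    have : G ^ (e + 1) - H ^ (e + 1) = (F - H ^ (e + 1)) - (F - G ^ (e + 1)) := by ring
    rw [this]
    exact (degree_sub_le _ _).trans_lt (max_lt hFH hFG)
  rw [← (Commute.all G H).geom_sum₂_mul] at hlt
  have hcoeff : (∑ i ∈ Finset.range (e + 1), G ^ i * H ^ (e + 1 - 1 - i)).coeff (e * N) =
      (e + 1 : ℕ) := by
    rw [finsetSum_coeff, Finset.sum_congr rfl (g := fun _ => (1 : R)), Finset.sum_const,
      Finset.card_range, nsmul_eq_mul, mul_one]
    intro i hi
    have hm : (G ^ i * H ^ (e + 1 - 1 - i)).Monic := (hG.pow _).mul (hH.pow _)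
    have hdeg : (G ^ i * H ^ (e + 1 - 1 - i)).natDegree = e * N := by
      rw [(hG.pow _).natDegree_mul (hH.pow _), hG.natDegree_pow, hH.natDegree_pow, hGN, hHN,
        ← add_mul]
      congr 1
      have := Finset.mem_range.1 hi
      omega
    rw [← hdeg]
    exact hm.coeff_natDegree
  have hle : ((e * N : ℕ) : WithBot ℕ) ≤
      (∑ i ∈ Finset.range (e + 1), G ^ i * H ^ (e + 1 - 1 - i)).degree :=
    le_degree_of_ne_zero (by rw [hcoeff]; exact_mod_cast Nat.succ_ne_zero e)
  rw [degree_mul, degree_eq_natDegree (sub_ne_zero.2 hne)] at hlt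
  refine absurd hlt (not_lt.2 (hle.trans ?_))
  exact le_add_of_nonneg_right (by positivity)

/-- All nonzero polynomials of degree `< N` have their value in `d ℤ`. -/
def ValuesDvd {K : Type*} [CommRing K] (v : Valuation K[X] ℤᵐ⁰) (N d : ℕ) : Prop :=
  ∀ h : K[X], h ≠ 0 → h.degree < N → ∃ a : ℤ, (d : ℤ) ∣ a ∧ v h = exp a

lemma ValuesDvd.mul {K : Type*} [Field K] {v : Valuation K[X] ℤᵐ⁰} {e d' : ℕ}
    {G : K[X]} {γ : ℤ} (hL : ValuesDvd v G.natDegree (e * d')) (hG : G.Monic) (hγ : v G = exp γ)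
    (hd' : (d' : ℤ) ∣ γ) (he : ∀ j : ℤ, ((e * d' : ℕ) : ℤ) ∣ j * γ → (e : ℤ) ∣ j) :
    ValuesDvd v (e * G.natDegree) d' := by
  intro h h0 hdeg
  obtain ⟨j, -, a, ha, hv⟩ := exists_val_eq v hG hγ (fun a ha => ha) hL he e le_rfl h h0 hdeg
  refine ⟨_, dvd_add (dvd_trans ?_ ha) (hd'.mul_left _), hv⟩
  push_cast
  exact dvd_mul_left _ _

lemma val_tschirnhausen {K : Type*} [Field K] {v : Valuation K[X] ℤᵐ⁰} {e d' : ℕ}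
    {F G : K[X]} {γ : ℤ} {u : K} (hL : ValuesDvd v G.natDegree ((e + 1) * d')) (hG : G.Monic)
    (hγ : v G = exp γ) (hndvd : ¬ (((e + 1) * d' : ℕ) : ℤ) ∣ γ) (hd' : (d' : ℤ) ∣ γ)
    (he : ∀ j : ℤ, (((e + 1) * d' : ℕ) : ℤ) ∣ j * γ → ((e + 1 : ℕ) : ℤ) ∣ j)
    (hF : F.Monic) (hFdeg : F.natDegree = (e + 1) * G.natDegree)
    (hFv : ∀ a : ℤ, (d' : ℤ) ∣ a → v F ≠ exp a) (hu : v (C u) = 1) :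
    v (G + C u * ((F - G ^ (e + 1)) /ₘ G ^ e)) = exp γ := by
  set W := F - G ^ (e + 1) with hW
  set c := W /ₘ G ^ e with hc
  have hGe : (G ^ e).Monic := hG.pow e
  have hGe1 : (G ^ (e + 1)).Monic := hG.pow _
  by_cases hc0 : c = 0
  · rw [hc0, mul_zero, add_zero, hγ]
  have hW0 : W ≠ 0 := by
    rintro h
    rw [hc, h, zero_divByMonic] at hc0
    exact hc0 rfl
  have hWdeg : W.degree < (((e + 1) * G.natDegree : ℕ) : WithBot ℕ) := by
    have hd : F.degree = (G ^ (e + 1)).degree := by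
      rw [degree_eq_natDegree hF.ne_zero, degree_eq_natDegree hGe1.ne_zero, hG.natDegree_pow,
        hFdeg]
    have := degree_sub_lt_left hd hF.ne_zero (by rw [hF.leadingCoeff, hGe1.leadingCoeff])
    rwa [degree_eq_natDegree hF.ne_zero, hFdeg] at this
  have hcdeg : c.degree < G.natDegree := by
    apply degree_divByMonic_lt_of_lt hGe
    rw [hG.natDegree_pow]
    convert hWdeg using 2
    ring
  obtain ⟨b, hb, hvW⟩ := hL.mul hG hγ hd' he W hW0 hWdeg
  obtain ⟨a, ha, hvc⟩ := hL c hc0 hcdeg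
  have hvG : v (G ^ (e + 1)) = exp ((e + 1) * γ) := by
    rw [map_pow, hγ, ← exp_nsmul, nsmul_eq_mul]
    push_cast
    rfl
  have hble : b ≤ (e + 1) * γ := by
    by_contra hlt
    have hlt' : v (G ^ (e + 1)) < v W := by
      rw [hvG, hvW, exp_lt_exp]
      exact not_le.1 hlt
    have := v.map_add_eq_of_lt_left hlt'
    rw [hW, sub_add_cancel, ← hW, hvW] at this
    exact hFv b hb this
  have hvGc : v (G ^ e * c) = exp (a + e * γ) := by
    rw [map_mul, map_pow, hγ, hvc, ← exp_nsmul, ← exp_add, nsmul_eq_mul, add_comm]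
  have hsum := modByMonic_add_div W (G ^ e)
  rw [← hc] at hsum
  have hle : v (G ^ e * c) ≤ v W := by
    by_cases hr0 : W %ₘ G ^ e = 0
    · rw [hr0, zero_add] at hsum
      rw [hsum]
    have hr : (W %ₘ G ^ e).degree < ((e * G.natDegree : ℕ) : WithBot ℕ) := by
      rw [← hG.natDegree_pow, ← degree_eq_natDegree hGe.ne_zero]
      exact degree_modByMonic_lt W hGe
    obtain ⟨j, hj, a', ha', hvr⟩ :=
      exists_val_eq v hG hγ (fun a ha => ha) hL he e (Nat.le_succ e) _ hr0 hr
    have hne : v (W %ₘ G ^ e) ≠ v (G ^ e * c) := by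
      rw [hvr, hvGc, Ne, exp_inj]
      intro heq
      have hd : (((e + 1) * d' : ℕ) : ℤ) ∣ ((e : ℤ) - j) * γ := by
        have : ((e : ℤ) - j) * γ = a' - a := by linear_combination -heq
        rw [this]
        exact dvd_sub ha' ha
      have := Int.le_of_dvd (by omega) (he _ hd)
      omega
    have hmax := v.map_add_of_distinct_val hne
    rw [hsum] at hmax
    rw [hmax]
    exact le_max_right _ _
  rw [hvGc, hvW, exp_le_exp] at hle
  have hlt : a < γ := lt_of_le_of_ne (by linarith) fun h => hndvd (h ▸ ha)
  rw [← hγ]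
  apply v.map_add_eq_of_lt_left
  rw [map_mul, hu, one_mul, hvc, hγ, exp_lt_exp]
  exact hlt

lemma exists_mul_eq_of_not_dvd {d : ℕ} (hd : 0 < d) {γ : ℤ} (h : ¬ (d : ℤ) ∣ γ) :
    ∃ e d' : ℕ, (e + 1) * d' = d ∧ 0 < e ∧ 0 < d' ∧ (d' : ℤ) ∣ γ ∧
      ∀ j : ℤ, (d : ℤ) ∣ j * γ → ((e + 1 : ℕ) : ℤ) ∣ j := by
  have hg : 0 < Int.gcd d γ := Int.gcd_pos_of_ne_zero_left _ (by exact_mod_cast hd.ne')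
  obtain ⟨e, he⟩ : Int.gcd d γ ∣ d := by exact_mod_cast Int.gcd_dvd_left (d : ℤ) γ
  obtain ⟨c, hc⟩ := Int.gcd_dvd_right (d : ℤ) γ
  have he1 : 1 < e := by
    rcases Nat.lt_or_ge 1 e with h1 | h1
    · exact h1
    interval_cases e
    · omega
    · exact absurd ⟨c, by rw [mul_one] at he; rwa [← he] at hc⟩ h
  refine ⟨e - 1, Int.gcd d γ, ?_, by omega, hg, Int.gcd_dvd_right _ _, fun j hj => ?_⟩
  · rw [Nat.sub_add_cancel he1.le, mul_comm, ← he]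
  · rw [Nat.sub_add_cancel he1.le]
    have hcop : IsCoprime (e : ℤ) c := by
      rw [Int.isCoprime_iff_gcd_eq_one]
      have h2 : Int.gcd ((Int.gcd d γ : ℤ) * e) ((Int.gcd d γ : ℤ) * c) = Int.gcd d γ := by
        rw [← hc, ← Nat.cast_mul, ← he]
      rw [Int.gcd_mul_left] at h2
      simp only [Int.natAbs_natCast] at h2
      exact Nat.eq_of_mul_eq_mul_left hg (by rw [h2, mul_one])
    have h3 : ((Int.gcd d γ : ℤ) * e) ∣ (Int.gcd d γ : ℤ) * (j * c) := by
      have : (Int.gcd d γ : ℤ) * (j * c) = j * γ := by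
        linear_combination -j * hc
      rw [this]
      exact_mod_cast he ▸ hj
    exact hcop.dvd_of_dvd_mul_right
      (Int.dvd_of_mul_dvd_mul_left (by exact_mod_cast hg.ne') h3)

/-- Key polynomials with coefficients in `K` can be replaced by ones with coefficients
in `R`, obtained as iterated approximate roots of `f`. -/
lemma exists_key_polynomial {R K : Type*} [CommRing R] [IsDomain R] [Field K] [CharZero K]
    {φ : R →+* K} (hφ : Function.Injective φ)
    (hunit : ∀ e : ℕ, e ≠ 0 → ∃ u : R, (e : R) * u = 1) {v : Valuation K[X] ℤᵐ⁰} {n : ℕ}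
    (hone : ∀ e : ℕ, e ≠ 0 → v (e : K[X]) = 1)
    (hkey : ∀ N d : ℕ, N * d = n → 0 < N → 1 < d → ValuesDvd v N d →
      ∃ G : K[X], G.Monic ∧ G.natDegree = N ∧ ∃ γ : ℤ, v G = exp γ ∧ ¬ (d : ℤ) ∣ γ)
    {f : R[X]} (hf : f.Monic) (hfn : f.natDegree = n) (hf0 : v (f.map φ) = 0) :
    ∀ d N : ℕ, N * d = n → 0 < N → 1 < d → ValuesDvd v N d →
      ∃ G : R[X], G.Monic ∧ G.natDegree = N ∧
        ∃ γ : ℤ, v (G.map φ) = exp γ ∧ ¬ (d : ℤ) ∣ γ := by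
  intro d
  induction d using Nat.strong_induction_on with
  | _ d ih =>
  intro N hNd hN hd hL
  obtain ⟨G₀, hG₀, hG₀N, γ, hγ, hndvd⟩ := hkey N d hNd hN hd hL
  obtain ⟨e, d', rfl, he0, hd_pos, hd', he⟩ := exists_mul_eq_of_not_dvd (by omega) hndvd
  obtain ⟨F, hF, hFdeg, hFv⟩ : ∃ F : R[X], F.Monic ∧ F.natDegree = (e + 1) * N ∧
      ∀ a : ℤ, (d' : ℤ) ∣ a → v (F.map φ) ≠ exp a := by
    rcases Nat.lt_or_ge 1 d' with h1 | h1
    · obtain ⟨F, hF, hFdeg, δ, hδ, hδd⟩ := ih d' (by nlinarith) ((e + 1) * N)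
        (by rw [← hNd]; ring) (by positivity) h1 (by
          subst hG₀N
          exact hL.mul hG₀ hγ hd' he)
      refine ⟨F, hF, hFdeg, fun a ha h => hδd ?_⟩
      rw [hδ, exp_inj] at h
      rwa [h]
    · obtain rfl : d' = 1 := by omega
      refine ⟨f, hf, by rw [hfn, ← hNd]; ring, fun a _ => ?_⟩
      rw [hf0]
      exact exp_ne_zero.symm
  obtain ⟨u, hu⟩ := hunit (e + 1) (Nat.succ_ne_zero e)
  have huK : ((e + 1 : ℕ) : K) * φ u = 1 := by
    have := congrArg φ hu
    rwa [map_mul, map_natCast, map_one] at this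
  have hvu : v (C (φ u)) = 1 := by
    have h1 : v (((e + 1 : ℕ) : K[X]) * C (φ u)) = 1 := by
      rw [← C_eq_natCast, ← C_mul, huK, C_1, map_one]
    rwa [map_mul, hone _ (Nat.succ_ne_zero e), one_mul] at h1
  obtain ⟨G, hG, hGN, -, hGF⟩ := exists_approximate_root hu hF hFdeg (fun _ => True)
    (fun _ _ _ _ => trivial) ⟨X ^ N, monic_X_pow N, natDegree_X_pow N, trivial⟩
  have hFK : (F.map φ).natDegree = (e + 1) * N := by rw [hF.natDegree_map, hFdeg]
  obtain ⟨H, hH, hHN, hHγ, hHF⟩ := exists_approximate_root huK (hF.map φ) hFK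
    (fun H => v H = exp γ)
    (fun H hH hHN hHγ => by
      subst hHN
      exact val_tschirnhausen hL hH hHγ hndvd hd' he (hF.map φ) hFK hFv hvu)
    ⟨G₀, hG₀, hG₀N, hγ⟩
  have hGH : G.map φ = H := by
    refine approximate_root_unique (hG.map φ) hH (by rw [hG.natDegree_map, hGN]) hHN ?_ hHF
    rwa [← Polynomial.map_pow, ← Polynomial.map_sub, degree_map_eq_of_injective hφ]
  exact ⟨G, hG, hGN, γ, by rw [hGH, hHγ], hndvd⟩

lemma ValuesDvd.comap {R K : Type*} [CommRing R] [Field K] {φ : R →+* K}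
    (hφ : Function.Injective φ) {v : Valuation K[X] ℤᵐ⁰} {N d : ℕ} (hL : ValuesDvd v N d) :
    ValuesDvd (v.comap (mapRingHom φ)) N d := fun h h0 hdeg =>
  hL (h.map φ) ((Polynomial.map_ne_zero_iff hφ).2 h0) (by rwa [degree_map_eq_of_injective hφ])

lemma gap_step {R : Type*} [CommRing R] [Nontrivial R] {w : Valuation R[X] ℤᵐ⁰} {e d : ℕ}
    {G : R[X]} {γ s : ℤ} (hL : ValuesDvd w G.natDegree d) (hG : G.Monic) (hγ : w G = exp γ)
    (he : ∀ j : ℤ, (d : ℤ) ∣ j * γ → ((e + 1 : ℕ) : ℤ) ∣ j) (hs : (d : ℤ) ∣ s)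
    (hgap : ∀ h : R[X], h.degree < G.natDegree → w h ≠ exp s) (h : R[X])
    (hh : h.degree < (((e + 1) * G.natDegree : ℕ) : WithBot ℕ)) : w h ≠ exp (s + e * γ) := by
  intro heq
  have h0 : h ≠ 0 := by
    rintro rfl
    rw [map_zero] at heq
    exact exp_ne_zero heq.symm
  obtain ⟨j, hj, a, ⟨had, has⟩, hv⟩ := exists_val_eq w (A := fun a => (d : ℤ) ∣ a ∧ a ≠ s) hG hγ
    (fun a ha => ha.1) (fun h h0 hdeg => by
      obtain ⟨a, ha, hv⟩ := hL h h0 hdeg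
      exact ⟨a, ⟨ha, fun has => hgap h hdeg (has ▸ hv)⟩, hv⟩) he (e + 1) le_rfl h h0 hh
  rw [hv, exp_inj] at heq
  have hd : (d : ℤ) ∣ ((e : ℤ) - j) * γ := by
    have : ((e : ℤ) - j) * γ = a - s := by linear_combination -heq
    rw [this]
    exact dvd_sub had hs
  have hej : (e : ℤ) - j = 0 := Int.eq_zero_of_dvd_of_nonneg_of_lt (by omega) (by omega) (he _ hd)
  have : (j : ℤ) = e := by omega
  rw [this] at heq
  exact has (by linarith)

lemma exists_gap {R K : Type*} [CommRing R] [IsDomain R] [Field K]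
    {φ : R →+* K} (hφ : Function.Injective φ) {v : Valuation K[X] ℤᵐ⁰} {n : ℕ}
    (hnonneg : ∀ (h : R[X]) (a : ℤ), v (h.map φ) = exp a → 0 ≤ a)
    (hkey : ∀ d N : ℕ, N * d = n → 0 < N → 1 < d → ValuesDvd v N d →
      ∃ G : R[X], G.Monic ∧ G.natDegree = N ∧
        ∃ γ : ℤ, v (G.map φ) = exp γ ∧ ¬ (d : ℤ) ∣ γ) :
    ∀ d N : ℕ, N * d = n → 0 < N → 0 < d → ValuesDvd v N d →
      ∀ s : ℤ, 0 ≤ s → (d : ℤ) ∣ s → (∀ h : R[X], h.degree < N → v (h.map φ) ≠ exp s) →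
      ∃ s : ℤ, 0 ≤ s ∧ ∀ h : R[X], h.degree < n → v (h.map φ) ≠ exp s := by
  intro d
  induction d using Nat.strong_induction_on with
  | _ d ih =>
  intro N hNd hN hd hL s hs hds hgap
  rcases Nat.lt_or_ge 1 d with h1 | h1
  · obtain ⟨G, hG, rfl, γ, hγ, hndvd⟩ := hkey d N hNd hN h1 hL
    have hGdeg : (G.map φ).natDegree = G.natDegree := hG.natDegree_map φ
    obtain ⟨e, d', rfl, he0, hd_pos, hd', he⟩ := exists_mul_eq_of_not_dvd hd hndvd
    refine ih d' (by nlinarith) ((e + 1) * G.natDegree) (by rw [← hNd]; ring) (by positivity)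
      hd_pos ?_ (s + e * γ) ?_ ?_ ?_
    · rw [← hGdeg] at hL ⊢
      exact hL.mul (hG.map φ) hγ hd' he
    · have := hnonneg G γ hγ
      positivity
    · refine dvd_add (dvd_trans ?_ hds) (hd'.mul_left _)
      push_cast
      exact dvd_mul_left _ _
    · exact gap_step (hL.comap hφ) hG hγ he hds hgap
  · obtain rfl : d = 1 := by omega
    obtain rfl : N = n := by omega
    exact ⟨s, hs, hgap⟩

section Curve

variable (p q : ℂ[X])

/-- Substitution of `(p, q)` into a polynomial in two variables. -/
noncomputable def evalCurve : ℂ[X][X] →ₐ[ℂ] ℂ[X] :=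
  eval₂AlgHom (aeval p) q fun _ => Commute.all _ _

lemma evalCurve_apply (h : ℂ[X][X]) :
    evalCurve p q h = eval₂ (aeval p : ℂ[X] →ₐ[ℂ] ℂ[X]).toRingHom q h := rfl

@[simp] lemma evalCurve_C (a : ℂ[X]) : evalCurve p q (C a) = a.comp p := by
  rw [evalCurve_apply, eval₂_C]
  rfl

@[simp] lemma evalCurve_X : evalCurve p q X = q := by
  rw [evalCurve_apply, eval₂_X]

variable {p q}

lemma evalCurve_surjective (hgen : Algebra.adjoin ℂ {p, q} = (⊤ : Subalgebra ℂ ℂ[X])) :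
    Function.Surjective (evalCurve p q) := by
  rw [← AlgHom.range_eq_top, ← top_le_iff, ← hgen, Algebra.adjoin_le_iff]
  rintro x (rfl | rfl)
  · exact ⟨C X, by simp⟩
  · exact ⟨X, by simp⟩

lemma comp_injective (hp : 1 ≤ p.natDegree) :
    Function.Injective (aeval p : ℂ[X] →ₐ[ℂ] ℂ[X]) := by
  rw [injective_iff_map_eq_zero]
  intro a ha
  change a.comp p = 0 at ha
  rcases comp_eq_zero_iff.1 ha with h | ⟨-, h⟩
  · exact h
  · rw [h, natDegree_C] at hp
    omega

/-- The equation of the curve, monic in the second variable. -/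
lemma exists_monic_equation (hp : 1 ≤ p.natDegree) :
    ∃ f : ℂ[X][X], f.Monic ∧ f.natDegree = p.natDegree ∧ evalCurve p q f = 0 := by
  have hp0 : p ≠ 0 := by
    rintro rfl
    simp at hp
  have hlc : p.leadingCoeff ≠ 0 := leadingCoeff_ne_zero.2 hp0
  have hdeg : (p.map C - C (X : ℂ[X])).natDegree = p.natDegree := by
    rw [natDegree_sub_C, natDegree_map_eq_of_injective C_injective]
  have hcoeff : (p.map C - C (X : ℂ[X])).coeff p.natDegree = C p.leadingCoeff := by
    rw [coeff_sub, coeff_map, coeff_C_of_ne_zero (by omega), sub_zero]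
    rfl
  set g : ℂ[X][X] := C (C p.leadingCoeff⁻¹) * (p.map C - C X) with hg
  have hCne : (C p.leadingCoeff⁻¹ : ℂ[X]) ≠ 0 := C_ne_zero.2 (inv_ne_zero hlc)
  have hgdeg : g.natDegree = p.natDegree := by
    rw [hg, natDegree_C_mul hCne, hdeg]
  have hgm : g.Monic := by
    rw [Monic, leadingCoeff, hgdeg, hg, coeff_C_mul, hcoeff, ← C_mul, inv_mul_cancel₀ hlc, C_1]
  have hroot : eval₂ (aeval p : ℂ[X] →ₐ[ℂ] ℂ[X]).toRingHom X g = 0 := by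
    have : eval₂ (aeval p : ℂ[X] →ₐ[ℂ] ℂ[X]).toRingHom X (p.map C - C (X : ℂ[X])) = 0 := by
      rw [eval₂_sub, eval₂_map, eval₂_C]
      have hC : (aeval p : ℂ[X] →ₐ[ℂ] ℂ[X]).toRingHom.comp C = C := by
        ext
        simp
      rw [hC, eval₂_C_X]
      simp
    rw [hg, eval₂_mul, this, mul_zero]
  let b := AdjoinRoot.powerBasis' hgm
  have := Module.Free.of_basis b.basis
  have := Module.Finite.of_basis b.basis
  set x : AdjoinRoot g := AdjoinRoot.mk g (q.map C) with hx
  refine ⟨(Algebra.lmul ℂ[X] (AdjoinRoot g) x).charpoly, LinearMap.charpoly_monic _, ?_, ?_⟩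
  · rw [LinearMap.charpoly_natDegree, b.finrank, AdjoinRoot.powerBasis'_dim, hgdeg]
  · have h1 := Algebra.aeval_self_charpoly_lmul (R := ℂ[X]) x
    have h2 := congrArg (AdjoinRoot.lift _ X hroot) h1
    rw [map_zero, aeval_def, hom_eval₂, hx, AdjoinRoot.lift_mk, eval₂_map] at h2
    have hC : (aeval p : ℂ[X] →ₐ[ℂ] ℂ[X]).toRingHom.comp C = C := by
      ext
      simp
    rw [hC, eval₂_C_X] at h2
    rw [evalCurve_apply, ← h2]
    congr 1
    ext a
    · simp
    · simp

/-- A valuation on `ℂ(x)[y]` extending `h ↦ deg h(p, q)` from `ℂ[x][y]`. -/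
structure IsCurveValuation (p q : ℂ[X]) (v : Valuation (RatFunc ℂ)[X] ℤᵐ⁰) : Prop where
  map_eq_zero : ∀ h : ℂ[X][X], evalCurve p q h = 0 → v (h.map (algebraMap _ _)) = 0
  map_eq_exp : ∀ h : ℂ[X][X], evalCurve p q h ≠ 0 →
    v (h.map (algebraMap _ _)) = exp ((evalCurve p q h).natDegree : ℤ)

lemma exists_isCurveValuation (hp : 1 ≤ p.natDegree) : ∃ v, IsCurveValuation p q v := by
  have hinj : Function.Injective
      ((algebraMap ℂ[X] (RatFunc ℂ)).comp (aeval p : ℂ[X] →ₐ[ℂ] ℂ[X]).toRingHom) :=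
    (IsFractionRing.injective ℂ[X] (RatFunc ℂ)).comp (comp_injective hp)
  let ψ : RatFunc ℂ →+* RatFunc ℂ := IsFractionRing.lift hinj
  let ev : (RatFunc ℂ)[X] →+* RatFunc ℂ := eval₂RingHom ψ (algebraMap ℂ[X] (RatFunc ℂ) q)
  have hev : ∀ h : ℂ[X][X], ev (h.map (algebraMap _ _)) =
      algebraMap ℂ[X] (RatFunc ℂ) (evalCurve p q h) := by
    intro h
    rw [evalCurve_apply, hom_eval₂]
    change eval₂ ψ _ (h.map _) = _
    rw [eval₂_map]
    congr 1
    exact RingHom.ext (IsFractionRing.lift_algebraMap hinj)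
  classical
  refine ⟨(RatFunc.inftyValuation ℂ).comap ev, fun h h0 => ?_, fun h h0 => ?_⟩
  · rw [Valuation.comap_apply, hev, h0, map_zero, map_zero]
  · rw [Valuation.comap_apply, hev]
    exact RatFunc.inftyValuation.polynomial ℂ h0

namespace IsCurveValuation

variable {v : Valuation (RatFunc ℂ)[X] ℤᵐ⁰}

lemma exists_map_C_eq (hv : IsCurveValuation p q v) (hp : 1 ≤ p.natDegree) {k : RatFunc ℂ} (hk : k ≠ 0) :
    ∃ a : ℤ, (p.natDegree : ℤ) ∣ a ∧ v (C k) = exp a := by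
  have hpoly : ∀ a : ℂ[X], a ≠ 0 →
      v (C (algebraMap ℂ[X] (RatFunc ℂ) a)) = exp (a.natDegree * p.natDegree : ℤ) := by
    intro a ha
    have hne : evalCurve p q (C a) ≠ 0 := by
      rw [evalCurve_C]
      exact (map_ne_zero_iff _ (comp_injective hp)).2 ha
    have := hv.map_eq_exp _ hne
    rw [map_C, evalCurve_C, natDegree_comp] at this
    exact_mod_cast this
  obtain ⟨a, b, hb, rfl⟩ := IsFractionRing.div_surjective (A := ℂ[X]) k
  have hb0 : b ≠ 0 := nonZeroDivisors.ne_zero hb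
  have ha0 : a ≠ 0 := by
    rintro rfl
    simp at hk
  have hbK : algebraMap ℂ[X] (RatFunc ℂ) b ≠ 0 := by simpa using hb0
  refine ⟨((a.natDegree : ℤ) - b.natDegree) * p.natDegree, dvd_mul_left _ _, ?_⟩
  have h1 : v (C (algebraMap ℂ[X] (RatFunc ℂ) a / algebraMap ℂ[X] (RatFunc ℂ) b)) *
      v (C (algebraMap ℂ[X] (RatFunc ℂ) b)) = v (C (algebraMap ℂ[X] (RatFunc ℂ) a)) := by
    rw [← map_mul, ← C_mul, div_mul_cancel₀ _ hbK]
  rw [hpoly a ha0, hpoly b hb0] at h1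
  rw [eq_div_of_mul_eq exp_ne_zero h1, ← exp_sub]
  ring_nf

lemma valuesDvd_one (hv : IsCurveValuation p q v) (hp : 1 ≤ p.natDegree) : ValuesDvd v 1 p.natDegree := by
  intro h h0 hdeg
  have hC : h = C (h.coeff 0) :=
    eq_C_of_degree_le_zero ((degree_le_iff_coeff_zero _ _).2 fun m hm =>
      (degree_lt_iff_coeff_zero _ _).1 hdeg m (by exact_mod_cast hm))
  rw [hC]
  apply hv.exists_map_C_eq hp
  intro h1
  rw [h1, C_0] at hC
  exact h0 hC

lemma map_natCast_eq_one (hv : IsCurveValuation p q v) {e : ℕ} (he : e ≠ 0) : v (e : (RatFunc ℂ)[X]) = 1 := by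
  have hne : evalCurve p q (e : ℂ[X][X]) ≠ 0 := by
    rw [map_natCast]
    exact_mod_cast he
  have := hv.map_eq_exp _ hne
  rw [Polynomial.map_natCast, map_natCast (evalCurve p q), natDegree_natCast] at this
  simpa using this

lemma nonneg (hv : IsCurveValuation p q v) {h : ℂ[X][X]} {a : ℤ} (ha : v (h.map (algebraMap _ _)) = exp a) : 0 ≤ a := by
  by_cases h0 : evalCurve p q h = 0
  · rw [hv.map_eq_zero h h0] at ha
    exact absurd ha.symm exp_ne_zero
  · rw [hv.map_eq_exp h h0, exp_inj] at ha
    omega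

/-- Counting dimensions: there are too many polynomials of degree `≤ N` in the second variable
for all of their values to be divisible by `d`. -/
lemma exists_not_dvd (hv : IsCurveValuation p q v) {N d : ℕ} (hNd : N * d = p.natDegree) (hN : 0 < N) (hd : 0 < d) :
    ∃ h : ℂ[X][X], h ≠ 0 ∧ h.degree < ((N + 1 : ℕ) : WithBot ℕ) ∧
      ∀ a : ℤ, (d : ℤ) ∣ a → v (h.map (algebraMap _ _)) ≠ exp a := by
  set D := N * q.natDegree with hD
  set M := N * q.natDegree + N * D + 1 with hM
  let B : Fin (N + 1) × Fin (D + 1) → ℂ[X][X] := fun x => monomial x.1 (X ^ (x.2 : ℕ))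
  let H : (Fin (N + 1) × Fin (D + 1) → ℂ) →ₗ[ℂ] ℂ[X][X] := Fintype.linearCombination ℂ B
  let T : (Fin (N + 1) × Fin (D + 1) → ℂ) →ₗ[ℂ] (Fin M → ℂ) :=
    LinearMap.pi fun i => (lcoeff ℂ (d * i)).comp ((evalCurve p q).toLinearMap.comp H)
  have hker : LinearMap.ker T ≠ ⊥ := by
    apply LinearMap.ker_ne_bot_of_finrank_lt
    simp only [Module.finrank_fintype_fun_eq_card, Fintype.card_fin, Fintype.card_prod]
    rw [hM]
    nlinarith
  obtain ⟨a, haT, ha0⟩ := (Submodule.ne_bot_iff _).1 hker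
  have hH : H a = ∑ x, a x • B x := Fintype.linearCombination_apply _ _ _
  have hBdeg : ∀ x, (B x).degree < ((N + 1 : ℕ) : WithBot ℕ) := fun x =>
    (degree_monomial_le _ _).trans_lt (by exact_mod_cast x.1.2)
  have hcoeff : ∀ x, ((H a).coeff x.1).coeff x.2 = a x := by
    intro x
    rw [hH, finsetSum_coeff, finsetSum_coeff, Finset.sum_eq_single x]
    · simp [B]
    · intro y _ hyx
      simp only [B, coeff_smul, coeff_monomial]
      split_ifs with h1
      · rw [coeff_X_pow, if_neg, smul_zero]
        intro h2
        exact hyx (Prod.ext (Fin.ext h1) (Fin.ext h2.symm))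
      · simp
    · simp
  have hsdeg : (evalCurve p q (H a)).natDegree ≤ d * (M - 1) := by
    rw [hH, map_sum]
    refine natDegree_sum_le_of_forall_le _ _ fun x _ => ?_
    rw [map_smul]
    refine (natDegree_smul_le _ _).trans ?_
    have hBx : evalCurve p q (B x) = p ^ (x.2 : ℕ) * q ^ (x.1 : ℕ) := by
      simp only [B, ← C_mul_X_pow_eq_monomial, map_mul, map_pow, evalCurve_C, evalCurve_X,
        X_comp]
    rw [hBx]
    refine natDegree_mul_le.trans ((add_le_add natDegree_pow_le natDegree_pow_le).trans ?_)
    have h1 : (x.1 : ℕ) ≤ N := Nat.lt_succ_iff.1 x.1.2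
    have h2 : (x.2 : ℕ) ≤ D := Nat.lt_succ_iff.1 x.2.2
    calc (x.2 : ℕ) * p.natDegree + x.1 * q.natDegree
        ≤ D * p.natDegree + N * q.natDegree := by gcongr
      _ ≤ D * (N * d) + d * (N * q.natDegree) := by
          rw [hNd]
          exact Nat.add_le_add_left (Nat.le_mul_of_pos_left _ hd) _
      _ = d * (M - 1) := by
          rw [hM, Nat.add_sub_cancel]
          ring
  refine ⟨H a, ?_, ?_, fun b hb hvb => ?_⟩
  · intro h0
    apply ha0
    ext x
    rw [← hcoeff x, h0]
    simp
  · rw [hH]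
    refine (degree_sum_le _ _).trans_lt ?_
    rw [Finset.sup_lt_iff (WithBot.bot_lt_coe _)]
    intro x _
    exact (degree_smul_le _ _).trans_lt (hBdeg x)
  · by_cases hs : evalCurve p q (H a) = 0
    · rw [hv.map_eq_zero _ hs] at hvb
      exact exp_ne_zero hvb.symm
    · rw [hv.map_eq_exp _ hs, exp_inj] at hvb
      obtain ⟨i, hi⟩ : d ∣ (evalCurve p q (H a)).natDegree := by
        rw [← hvb] at hb
        exact_mod_cast hb
      have hiM : i < M := by
        rw [hi] at hsdeg
        have := Nat.le_of_mul_le_mul_left hsdeg hd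
        omega
      have := congrFun (LinearMap.mem_ker.1 haT) ⟨i, hiM⟩
      change (evalCurve p q (H a)).coeff (d * i) = 0 at this
      rw [← hi] at this
      exact hs (leadingCoeff_eq_zero.1 this)

lemma exists_monic_not_dvd (hv : IsCurveValuation p q v) (hp : 1 ≤ p.natDegree)
    (hgen : Algebra.adjoin ℂ {p, q} = (⊤ : Subalgebra ℂ ℂ[X]))
    {N d : ℕ} (hNd : N * d = p.natDegree) (hN : 0 < N) (hd : 1 < d) (hL : ValuesDvd v N d) :
    ∃ G : (RatFunc ℂ)[X], G.Monic ∧ G.natDegree = N ∧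
      ∃ γ : ℤ, v G = exp γ ∧ ¬ (d : ℤ) ∣ γ := by
  obtain ⟨h, h0, hdeg, hval⟩ := hv.exists_not_dvd hNd hN (by omega)
  set hK := h.map (algebraMap ℂ[X] (RatFunc ℂ)) with hh_eq
  have hinj := IsFractionRing.injective ℂ[X] (RatFunc ℂ)
  have hK_ne : hK ≠ 0 := (Polynomial.map_ne_zero_iff hinj).2 h0
  have hK_deg : hK.natDegree = N := by
    rw [← degree_map_eq_of_injective hinj h, ← hh_eq, degree_eq_natDegree hK_ne] at hdeg
    norm_cast at hdeg
    by_contra hne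
    obtain ⟨a, ha, hva⟩ := hL hK hK_ne (by
      rw [degree_eq_natDegree hK_ne]
      exact_mod_cast (by omega : hK.natDegree < N))
    exact hval a ha hva
  have hlc : hK.leadingCoeff⁻¹ ≠ 0 := inv_ne_zero (leadingCoeff_ne_zero.2 hK_ne)
  obtain ⟨b, hb, hvb⟩ := hv.exists_map_C_eq hp hlc
  have hdb : (d : ℤ) ∣ b := dvd_trans ⟨N, by rw [← hNd]; push_cast; ring⟩ hb
  have hG : (C hK.leadingCoeff⁻¹ * hK).Monic := by
    rw [mul_comm]
    exact monic_mul_leadingCoeff_inv hK_ne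
  have hGN : (C hK.leadingCoeff⁻¹ * hK).natDegree = N := by rw [natDegree_C_mul hlc, hK_deg]
  refine ⟨_, hG, hGN, ?_⟩
  by_cases hvh : v hK = 0
  · exfalso
    obtain ⟨g, hg⟩ := evalCurve_surjective hgen X
    have hvg := hv.map_eq_exp g (by rw [hg]; exact X_ne_zero)
    rw [hg, natDegree_X] at hvg
    set g' := g.map (algebraMap ℂ[X] (RatFunc ℂ))
    set G := C hK.leadingCoeff⁻¹ * hK
    have hvr : v (g' %ₘ G) = exp 1 := by
      rw [modByMonic_eq_sub_mul_div g' G, v.map_sub_eq_of_lt_left, hvg]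
      · rfl
      · rw [hvg, map_mul, map_mul, hvh, mul_zero, zero_mul]
        exact exp_pos
    have hr0 : g' %ₘ G ≠ 0 := by
      intro h1
      rw [h1, map_zero] at hvr
      exact exp_ne_zero hvr.symm
    obtain ⟨a, ha, hva⟩ := hL _ hr0 (by
      rw [← hGN, ← degree_eq_natDegree hG.ne_zero]
      exact degree_modByMonic_lt _ hG)
    rw [hvr, exp_inj] at hva
    rw [← hva] at ha
    have := Int.le_of_dvd one_pos ha
    omega
  · refine ⟨b + log (v hK), by rw [map_mul, hvb, exp_add, exp_log hvh], fun hdvd => ?_⟩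
    exact hval _ ((dvd_add_right hdb).1 hdvd) (exp_log hvh).symm

end IsCurveValuation

end Curve

end AbhyankarMoh

open AbhyankarMoh in
/-- **Classical Abhyankar–Moh theorem on degrees.**
If `p, q ∈ ℂ[t]` are nonconstant polynomials generating `ℂ[t]` as a
`ℂ`-algebra (i.e. `ℂ[p,q] = ℂ[t]`), then `deg p` divides `deg q` or
`deg q` divides `deg p`. -/
theorem abhyankar_moh_degrees
    (p q : Polynomial ℂ) (hp : 1 ≤ p.natDegree) (hq : 1 ≤ q.natDegree)
    (hgen : Algebra.adjoin ℂ {p, q} = (⊤ : Subalgebra ℂ (Polynomial ℂ))) :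
    p.natDegree ∣ q.natDegree ∨ q.natDegree ∣ p.natDegree := by
  by_contra! hcon
  obtain ⟨hpq, hqp⟩ := hcon
  obtain ⟨v, hv⟩ := exists_isCurveValuation (q := q) hp
  have hinj := IsFractionRing.injective ℂ[X] (RatFunc ℂ)
  obtain ⟨f, hf, hfn, hf0⟩ := exists_monic_equation (q := q) hp
  have hunit : ∀ e : ℕ, e ≠ 0 → ∃ u : ℂ[X], (e : ℂ[X]) * u = 1 := fun e he =>
    ⟨C (e : ℂ)⁻¹, by
      rw [← C_eq_natCast, ← C_mul, mul_inv_cancel₀ (by exact_mod_cast he), C_1]⟩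
  have hkey := exists_key_polynomial hinj hunit (fun e => hv.map_natCast_eq_one)
    (fun N d => hv.exists_monic_not_dvd hp hgen) hf hfn (hv.map_eq_zero f hf0)
  have hq0 : evalCurve p q X ≠ 0 := by
    rw [evalCurve_X]
    rintro rfl
    simp at hq
  have hvX : v ((X : ℂ[X][X]).map (algebraMap _ (RatFunc ℂ))) = exp (q.natDegree : ℤ) := by
    rw [hv.map_eq_exp _ hq0, evalCurve_X]
  have hL := hv.valuesDvd_one hp
  obtain ⟨e, d', hed, he0, hd_pos, hd', he⟩ :=
    exists_mul_eq_of_not_dvd hp (γ := (q.natDegree : ℤ)) (by exact_mod_cast hpq)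
  have hLe : ValuesDvd v (e + 1) d' := by
    have h1 : (X : (RatFunc ℂ)[X]).natDegree = 1 := natDegree_X
    rw [map_X] at hvX
    have := ValuesDvd.mul (e := e + 1) (d' := d') (by rwa [h1, hed]) monic_X hvX hd'
      (by rwa [hed])
    rwa [h1, mul_one] at this
  obtain ⟨m, hm⟩ : d' ∣ q.natDegree := by exact_mod_cast hd'
  have hm2 : 2 ≤ m := by
    rcases Nat.lt_or_ge m 2 with h | h
    · interval_cases m
      · omega
      · exact absurd ⟨e + 1, by rw [hm, mul_one, ← hed, mul_comm]⟩ hqp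
    · exact h
  have hbound : p.natDegree ≤ e * q.natDegree := by
    rw [hm, ← hed]
    calc (e + 1) * d' ≤ (e * m) * d' := by gcongr; nlinarith
      _ = e * (d' * m) := by ring
  obtain ⟨s, hs, hgap⟩ := exists_gap hinj (fun h a => hv.nonneg) hkey d' (e + 1) hed
    (Nat.succ_pos e) hd_pos hLe (-p.natDegree + e * q.natDegree)
    (by have : (p.natDegree : ℤ) ≤ e * q.natDegree := by exact_mod_cast hbound
        linarith)
    (dvd_add (by rw [dvd_neg, ← hed]; push_cast; exact dvd_mul_left _ _) (hd'.mul_left _)) (by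
      intro h hh
      refine gap_step (w := v.comap (mapRingHom (algebraMap ℂ[X] (RatFunc ℂ)))) (G := X)
        (d := p.natDegree) ?_ monic_X hvX he (dvd_neg.2 dvd_rfl) ?_ h ?_
      · rw [natDegree_X]
        exact hL.comap hinj
      · intro h _ heq
        have := hv.nonneg heq
        omega
      · rwa [natDegree_X, mul_one])
  obtain ⟨g, hg⟩ := evalCurve_surjective hgen (X ^ s.toNat)
  have hr : evalCurve p q (g %ₘ f) = X ^ s.toNat := by
    rw [modByMonic_eq_sub_mul_div g f, map_sub, map_mul, hf0, zero_mul, sub_zero, hg]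
  refine hgap (g %ₘ f) ?_ ?_
  · rw [← hfn, ← degree_eq_natDegree hf.ne_zero]
    exact degree_modByMonic_lt _ hf
  · rw [hv.map_eq_exp _ (by rw [hr]; exact pow_ne_zero _ X_ne_zero), hr, natDegree_X_pow,
      Int.toNat_of_nonneg hs]
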